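/- For every n ≥ 1, the diameter of the tilde-Fibonacci cube F̃_n equals ⌈n/2⌉; in particular, for even n the maximal distance is realized by the words (10)^{n/2} and (01)^{n/2}, and for odd n by (01)^{⌊n/2⌋}0 and (10)^{⌊n/2⌋}1. -/

import Mathlib

/-- One tilde edit step: a replacement (flip one symbol) or a swap of two
adjacent distinct symbols. -/
inductive TStep : List Bool → List Bool → Prop
  | repl (x y : List Bool) (a : Bool) : TStep (x ++ a :: y) (x ++ (!a) :: y)
  | swap (x y : List Bool) (a : Bool) : TStep (x ++ a :: (!a) :: y) (x ++ (!a) :: a :: y)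

/-- `reach step h u v` : `v` can be obtained from `u` by a chain of `h` steps. -/
def reach (step : List Bool → List Bool → Prop) : ℕ → List Bool → List Bool → Prop
  | 0 => Eq
  | h + 1 => fun u v => ∃ w, step u w ∧ reach step h w v

/-- The tilde-distance: the minimum number of replacements and swaps needed to
transform `u` into `v`. -/
noncomputable def tildeDist (u v : List Bool) : ℕ := sInf {h | reach TStep h u v}

theorem TStep.symm {u v : List Bool} (h : TStep u v) : TStep v u := by
  cases h with
  | repl x y a => simpa using TStep.repl x y (!a)
  | swap x y a => simpa using TStep.swap x y (!a)

theorem reach_snoc {step : List Bool → List Bool → Prop} :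
    ∀ {h : ℕ} {u v w : List Bool}, reach step h u v → step v w → reach step (h + 1) u w := by
  intro h
  induction h with
  | zero => intro u v w r s; exact ⟨w, r ▸ s, rfl⟩
  | succ h ih => intro u v w r s; obtain ⟨z, su, rz⟩ := r; exact ⟨z, su, ih rz s⟩

theorem reach_symm : ∀ {h : ℕ} {u v : List Bool}, reach TStep h u v → reach TStep h v u := by
  intro h
  induction h with
  | zero => intro u v r; exact r.symm
  | succ h ih => intro u v r; obtain ⟨w, s, rw⟩ := r; exact reach_snoc (ih rw) s.symm

theorem tildeDist_comm (u v : List Bool) : tildeDist u v = tildeDist v u := by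
  unfold tildeDist
  congr 1
  ext h
  exact ⟨fun r => reach_symm r, fun r => reach_symm r⟩

theorem tildeDist_self (u : List Bool) : tildeDist u u = 0 :=
  Nat.sInf_eq_zero.mpr (Or.inl rfl)

/-- The Hamming distance: the number of positions at which `u` and `v` differ. -/
def hammDist (u v : List Bool) : ℕ := ((u.zip v).filter fun p => p.1 != p.2).length

theorem hammDist_comm : ∀ u v : List Bool, hammDist u v = hammDist v u
  | [], [] => rfl
  | [], _ :: _ => rfl
  | _ :: _, [] => rfl
  | a :: u, b :: v => by
    cases a <;> cases b <;>
      simp [hammDist, List.filter_cons, hammDist_comm u v, hammDist] <;>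
      simpa [hammDist] using hammDist_comm u v

theorem hammDist_self : ∀ u : List Bool, hammDist u u = 0
  | [] => rfl
  | a :: u => by simpa [hammDist, List.filter_cons] using hammDist_self u

/-- Binary words of length `n`. -/
abbrev Word (n : ℕ) := {w : List Bool // w.length = n}

/-- The `n`-tilde-hypercube: vertices are the binary words of length `n`, and
two vertices are adjacent iff their tilde-distance is `1`. -/
noncomputable def tildeCube (n : ℕ) : SimpleGraph (Word n) where
  Adj u v := tildeDist u.val v.val = 1
  symm := ⟨by intro u v h; rwa [tildeDist_comm]⟩
  loopless := ⟨by intro u h; rw [tildeDist_self] at h; exact one_ne_zero h.symm⟩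

/-- The `n`-hypercube: vertices are the binary words of length `n`, and
two vertices are adjacent iff their Hamming distance is `1`. -/
def hamCube (n : ℕ) : SimpleGraph (Word n) where
  Adj u v := hammDist u.val v.val = 1
  symm := ⟨by intro u v h; rwa [hammDist_comm]⟩
  loopless := ⟨by intro u h; rw [hammDist_self] at h; exact one_ne_zero h.symm⟩

/-- `f` is tilde-isometric. -/
def TildeIsometric (f : List Bool) : Prop :=
  ∀ n : ℕ, f.length ≤ n → ∀ u v : List Bool, u.length = n → v.length = n →
    ¬ f <:+: u → ¬ f <:+: v →
    ∃ w : ℕ → List Bool, w 0 = u ∧ w (tildeDist u v) = v ∧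
      (∀ k < tildeDist u v, tildeDist (w k) (w (k + 1)) = 1) ∧
      (∀ k ≤ tildeDist u v, ¬ f <:+: w k)

/-- `f` is Ham-isometric. -/
def HamIsometric (f : List Bool) : Prop :=
  ∀ u v : List Bool, u.length = v.length →
    ¬ f <:+: u → ¬ f <:+: v →
    ∃ w : ℕ → List Bool, w 0 = u ∧ w (hammDist u v) = v ∧
      (∀ k ≤ hammDist u v, (w k).length = u.length) ∧
      (∀ k < hammDist u v, hammDist (w k) (w (k + 1)) = 1) ∧
      (∀ k ≤ hammDist u v, ¬ f <:+: w k)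
/-- The set of words of length `n` avoiding the factor `11`. -/
def fibFree (n : ℕ) : Set (Word n) := {w | ¬ [true, true] <:+: w.val}

/-- The `n`-tilde-Fibonacci cube: the subgraph of the tilde-hypercube induced by
the words avoiding the factor `11`. -/
noncomputable def tildeFibCube (n : ℕ) : SimpleGraph (fibFree n) :=
  (tildeCube n).induce (fibFree n)

/-- The `n`-Fibonacci cube: the subgraph of the hypercube induced by
the words avoiding the factor `11`. -/
def fibCube (n : ℕ) : SimpleGraph (fibFree n) :=
  (hamCube n).induce (fibFree n)

/-- `okw b w`: the word `b w` avoids `11`. -/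
def okw : Bool → List Bool → Prop
  | _, [] => True
  | b, a :: l => ¬ (b = true ∧ a = true) ∧ okw a l

theorem okw_false_of {b : Bool} {l : List Bool} (h : okw b l) : okw false l := by
  cases l with
  | nil => trivial
  | cons a l => exact ⟨by simp, h.2⟩

theorem okw_iff (l : List Bool) : ∀ b, okw b l ↔ ¬ [true, true] <:+: (b :: l) := by
  induction l with
  | nil =>
    intro b
    simp only [okw, true_iff]
    intro h
    have := h.length_le
    simp at this
  | cons a l ih =>
    intro b
    rw [List.infix_cons_iff, okw, ih a]
    cases a <;> cases b <;> simp [List.cons_prefix_cons]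

theorem okw_false_iff (l : List Bool) : okw false l ↔ ¬ [true, true] <:+: l := by
  rw [okw_iff, List.infix_cons_iff]
  simp [List.cons_prefix_cons]

theorem TStep.cons {u v : List Bool} (c : Bool) (h : TStep u v) : TStep (c :: u) (c :: v) := by
  cases h with
  | repl x y a => exact TStep.repl (c :: x) y a
  | swap x y a => exact TStep.swap (c :: x) y a

theorem TStep.ne {u v : List Bool} (h : TStep u v) : u ≠ v := by
  cases h with
  | repl x y a => cases a <;> simp
  | swap x y a => cases a <;> simp

theorem TStep.length_eq {u v : List Bool} (h : TStep u v) : u.length = v.length := by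
  cases h <;> simp

theorem tildeDist_eq_one_iff {u v : List Bool} : tildeDist u v = 1 ↔ TStep u v := by
  constructor
  · intro h
    have hne : {h | reach TStep h u v}.Nonempty := by
      by_contra hc
      rw [Set.not_nonempty_iff_eq_empty] at hc
      rw [tildeDist, hc] at h
      simp at h
    have := Nat.sInf_mem hne
    change reach TStep (tildeDist u v) u v at this
    rw [h] at this
    obtain ⟨w, s, e⟩ := this
    cases e
    exact s
  · intro h
    have h1 : tildeDist u v ≤ 1 := Nat.sInf_le (show reach TStep 1 u v from ⟨v, h, rfl⟩)
    have h0 : tildeDist u v ≠ 0 := by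
      intro h0
      have hm := Nat.sInf_mem (s := {h | reach TStep h u v}) ⟨1, v, h, rfl⟩
      change reach TStep (tildeDist u v) u v at hm
      rw [h0] at hm
      exact h.ne hm
    omega

/-- A step staying within the words `w` with `b w` avoiding `11`. -/
def fstep (b : Bool) (u v : List Bool) : Prop := TStep u v ∧ okw b v

theorem reach_map {s t : List Bool → List Bool → Prop} (f : List Bool → List Bool)
    (hf : ∀ u v, s u v → t (f u) (f v)) :
    ∀ (m : ℕ) (u v : List Bool), reach s m u v → reach t m (f u) (f v) := by
  intro m
  induction m with
  | zero => intro u v h; exact congrArg f h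
  | succ m ih =>
    rintro u v ⟨w, h1, h2⟩
    exact ⟨f w, hf _ _ h1, ih _ _ h2⟩

theorem block (b x y z w : Bool) (l : List Bool) (hu : okw b [x, y]) (hv : okw b [z, w]) :
    [x, y] = [z, w] ∨ TStep (x :: y :: l) (z :: w :: l) := by
  cases x <;> cases y <;> cases z <;> cases w <;> simp_all [okw]
  · exact TStep.repl [false] l false
  · exact TStep.repl [] (false :: l) false
  · exact TStep.repl [false] l true
  · exact TStep.swap [] l false
  · exact TStep.repl [] (false :: l) true
  · exact TStep.swap [] l true

theorem upper : ∀ (n : ℕ) (b : Bool) (u v : List Bool), u.length = n → v.length = n →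
    okw b u → okw b v → ∃ m, m ≤ (n + 1) / 2 ∧ reach (fstep b) m u v := by
  intro n
  induction n using Nat.strong_induction_on with
  | _ n ih =>
  intro b u v hu hv ou ov
  match u, v, hu, hv, ou, ov with
  | [], [], _, _, _, _ => exact ⟨0, by omega, rfl⟩
  | [], _ :: _, h, h', _, _ => simp at h h'; omega
  | _ :: _, [], h, h', _, _ => simp at h h'; omega
  | [x], [y], h, _, _, ov =>
    simp at h
    by_cases e : x = y
    · exact ⟨0, by omega, by rw [e]; rfl⟩
    · refine ⟨1, by omega, [y], ⟨?_, ov⟩, rfl⟩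
      have : y = !x := by cases x <;> cases y <;> simp_all
      rw [this]
      exact TStep.repl [] [] x
  | [_], _ :: _ :: _, h, h', _, _ => simp at h h'; omega
  | _ :: _ :: _, [_], h, h', _, _ => simp at h h'; omega
  | x :: y :: u, z :: w :: v, h, h', ou, ov =>
    simp at h h'
    obtain ⟨o1, o2, o3⟩ := ou
    obtain ⟨p1, p2, p3⟩ := ov
    have lift : ∀ (c : Bool) (m : ℕ) (u v : List Bool) (z w : Bool), ¬ (b = true ∧ z = true) →
        ¬ (z = true ∧ w = true) → (w = true → c = true) →
        reach (fstep c) m u v → reach (fstep b) m (z :: w :: u) (z :: w :: v) := by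
      intro c m u v z w h1 h2 h3 hr
      refine reach_map (fun l => z :: w :: l) ?_ m u v hr
      rintro s t ⟨st, ot⟩
      refine ⟨(st.cons w).cons z, h1, h2, ?_⟩
      cases w
      · exact okw_false_of ot
      · rw [h3 rfl] at ot; exact ot
    by_cases hc : okw w u
    · obtain ⟨m, hm, hr⟩ := ih (n - 2) (by omega) w u v (by omega) (by omega) hc p3
      have hr' := lift w m u v z w p1 p2 id hr
      rcases block b x y z w u ⟨o1, o2, trivial⟩ ⟨p1, p2, trivial⟩ with e | e
      · simp only [List.cons.injEq, and_true] at e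
        obtain ⟨rfl, rfl⟩ := e
        exact ⟨m, by omega, hr'⟩
      · exact ⟨m + 1, by omega, _, ⟨e, p1, p2, hc⟩, hr'⟩
    · have hy : y = false := by
        cases y
        · rfl
        · exfalso
          cases w
          · exact hc (okw_false_of o3)
          · exact hc o3
      subst hy
      obtain ⟨m, hm, hr⟩ := ih (n - 2) (by omega) false u v (by omega) (by omega) o3
        (okw_false_of p3)
      have hr' := lift false m u v x false o1 o2 id hr
      rcases block b x false z w v ⟨o1, o2, trivial⟩ ⟨p1, p2, trivial⟩ with e | e
      · simp only [List.cons.injEq, and_true] at e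
        obtain ⟨rfl, rfl⟩ := e
        exact ⟨m, by omega, hr'⟩
      · exact ⟨m + 1, by omega, reach_snoc hr' ⟨e, p1, p2, p3⟩⟩

theorem walk_of_reach (n : ℕ) : ∀ (m : ℕ) (u v : fibFree n),
    reach (fstep false) m u.val.val v.val.val → ∃ p : (tildeFibCube n).Walk u v, p.length = m := by
  intro m
  induction m with
  | zero =>
    intro u v h
    have : u = v := Subtype.ext (Subtype.ext h)
    subst this
    exact ⟨SimpleGraph.Walk.nil, rfl⟩
  | succ m ih =>
    rintro u v ⟨w, ⟨h1, h2⟩, h3⟩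
    let w' : fibFree n := ⟨⟨w, h1.length_eq.symm.trans u.val.2⟩, (okw_false_iff w).1 h2⟩
    obtain ⟨p, hp⟩ := ih w' v h3
    have ha : (tildeFibCube n).Adj u w' := tildeDist_eq_one_iff.2 h1
    exact ⟨SimpleGraph.Walk.cons ha p, by simp [hp]⟩

theorem exists_walk (n : ℕ) (u v : fibFree n) :
    ∃ p : (tildeFibCube n).Walk u v, p.length ≤ (n + 1) / 2 := by
  obtain ⟨m, hm, hr⟩ := upper n false u.val.val v.val.val u.val.2 v.val.2
    ((okw_false_iff _).2 u.2) ((okw_false_iff _).2 v.2)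
  obtain ⟨p, hp⟩ := walk_of_reach n m u v hr
  exact ⟨p, hp ▸ hm⟩

theorem hamm_cons (a b : Bool) (u v : List Bool) :
    hammDist (a :: u) (b :: v) = (if a = b then 0 else 1) + hammDist u v := by
  cases a <;> cases b <;> simp [hammDist, List.filter_cons, Nat.add_comm]

theorem hamm_nil (u : List Bool) : hammDist u [] = 0 := by simp [hammDist]

theorem hamm_step {u w : List Bool} (h : TStep u w) (v : List Bool) :
    hammDist u v ≤ hammDist w v + 2 := by
  cases h with
  | repl x y a =>
    induction x generalizing v with
    | nil =>
      cases v with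
      | nil => simp [hamm_nil]
      | cons c v => simp only [List.nil_append, hamm_cons]; split_ifs <;> omega
    | cons d x ih =>
      cases v with
      | nil => simp [hamm_nil]
      | cons c v => have := ih v; simp only [List.cons_append, hamm_cons]; omega
  | swap x y a =>
    induction x generalizing v with
    | nil =>
      rcases v with _ | ⟨c, _ | ⟨d, v⟩⟩
      · simp [hamm_nil]
      · simp only [List.nil_append, hamm_cons, hamm_nil]; split_ifs <;> omega
      · simp only [List.nil_append, hamm_cons]; split_ifs <;> omega
    | cons d x ih =>
      cases v with
      | nil => simp [hamm_nil]
      | cons c v => have := ih v; simp only [List.cons_append, hamm_cons]; omega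

theorem hamm_walk (n : ℕ) (u v : fibFree n) (p : (tildeFibCube n).Walk u v) :
    hammDist u.val.val v.val.val ≤ 2 * p.length := by
  induction p with
  | nil => simp [hammDist_self]
  | @cons u w v h p ih =>
    have := hamm_step (tildeDist_eq_one_iff.1 (show tildeDist u.val.val w.val.val = 1 from h))
      v.val.val
    simp only [SimpleGraph.Walk.length_cons]
    omega

theorem dist_eq_of_hamm (n : ℕ) (u v : fibFree n) (h : hammDist u.val.val v.val.val = n) :
    (tildeFibCube n).dist u v = (n + 1) / 2 := by
  obtain ⟨p, hp⟩ := exists_walk n u v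
  have h1 := SimpleGraph.dist_le p
  obtain ⟨q, hq⟩ := (p.reachable).exists_walk_length_eq_dist
  have h2 := hamm_walk n u v q
  omega

theorem hamm_alt (a : Bool) (s t : List Bool) (k : ℕ) :
    hammDist ((List.replicate k [a, !a]).flatten ++ s) ((List.replicate k [!a, a]).flatten ++ t)
      = 2 * k + hammDist s t := by
  induction k with
  | zero => simp
  | succ k ih =>
    simp only [List.replicate_succ, List.flatten_cons, List.cons_append, List.nil_append,
      hamm_cons, ih]
    cases a <;> simp <;> omega

theorem okw_ft (s : List Bool) (k : ℕ) (hs : okw true s) (c : Bool) (hc : okw c s) :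
    okw c ((List.replicate k [false, true]).flatten ++ s) := by
  induction k generalizing c with
  | zero => simpa using hc
  | succ k ih =>
    simp only [List.replicate_succ, List.flatten_cons, List.cons_append, List.nil_append, okw]
    exact ⟨by simp, by simp, ih true hs⟩

theorem okw_tf (s : List Bool) (k : ℕ) (hs : okw false s) :
    okw false ((List.replicate k [true, false]).flatten ++ s) := by
  induction k with
  | zero => simpa using hs
  | succ k ih =>
    simp only [List.replicate_succ, List.flatten_cons, List.cons_append, List.nil_append, okw]
    exact ⟨by simp, by simp, ih⟩

theorem exists_far (n : ℕ) : ∃ u v : fibFree n, hammDist u.val.val v.val.val = n := by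
  rcases Nat.even_or_odd' n with ⟨k, rfl | rfl⟩
  · refine ⟨⟨⟨(List.replicate k [true, false]).flatten ++ [], ?_⟩,
      (okw_false_iff _).1 (okw_tf [] _ trivial)⟩,
      ⟨⟨(List.replicate k [false, true]).flatten ++ [], ?_⟩,
      (okw_false_iff _).1 (okw_ft [] _ trivial _ trivial)⟩, ?_⟩
    · simp; omega
    · simp; omega
    · exact hamm_alt true [] [] k
  · refine ⟨⟨⟨(List.replicate k [true, false]).flatten ++ [true], ?_⟩,
      (okw_false_iff _).1 (okw_tf _ _ (by simp [okw]))⟩,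
      ⟨⟨(List.replicate k [false, true]).flatten ++ [false], ?_⟩,
      (okw_false_iff _).1 (okw_ft _ _ (by simp [okw]) _ (by simp [okw]))⟩, ?_⟩
    · simp; omega
    · simp; omega
    · exact hamm_alt true [true] [false] k

/-- The diameter of the tilde-Fibonacci cube is `⌈n/2⌉`, realized for even `n`
by `(10)^{n/2}` and `(01)^{n/2}`, and for odd `n` by `(01)^{⌊n/2⌋}0` and
`(10)^{⌊n/2⌋}1`. -/
theorem tildeFibCube_diam (n : ℕ) (hn : 1 ≤ n) :
    (tildeFibCube n).diam = (n + 1) / 2 ∧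
    (Even n → ∀ u v : fibFree n,
      u.val.val = List.flatten (List.replicate (n / 2) [true, false]) →
      v.val.val = List.flatten (List.replicate (n / 2) [false, true]) →
      (tildeFibCube n).dist u v = (n + 1) / 2) ∧
    (Odd n → ∀ u v : fibFree n,
      u.val.val = List.flatten (List.replicate (n / 2) [false, true]) ++ [false] →
      v.val.val = List.flatten (List.replicate (n / 2) [true, false]) ++ [true] →
      (tildeFibCube n).dist u v = (n + 1) / 2) := by
  refine ⟨?_, ?_, ?_⟩
  · have hle : (tildeFibCube n).ediam ≤ ((n + 1) / 2 : ℕ) := by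
      apply SimpleGraph.ediam_le_of_edist_le
      intro u v
      obtain ⟨p, hp⟩ := exists_walk n u v
      exact (SimpleGraph.edist_le p).trans (by exact_mod_cast hp)
    have hne : (tildeFibCube n).ediam ≠ ⊤ := ne_top_of_le_ne_top (ENat.coe_ne_top _) hle
    obtain ⟨u, v, h⟩ := exists_far n
    apply le_antisymm
    · exact ENat.toNat_le_of_le_coe hle
    · rw [← dist_eq_of_hamm n u v h]
      exact SimpleGraph.dist_le_diam hne
  · rintro he u v hu hv
    apply dist_eq_of_hamm
    rw [hu, hv]
    have := hamm_alt true [] [] (n / 2)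
    simp only [List.append_nil, Bool.not_true] at this
    rw [this, hammDist_self]
    have := Nat.two_mul_div_two_of_even he
    omega
  · rintro ho u v hu hv
    apply dist_eq_of_hamm
    rw [hu, hv]
    have := hamm_alt false [false] [true] (n / 2)
    simp only [Bool.not_false] at this
    rw [this]
    have h1 : hammDist [false] [true] = 1 := rfl
    rw [h1]
    exact Nat.two_mul_div_two_add_one_of_odd ho
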